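/- The chain consistency probability of the embedded star Hamiltonian satisfies P_cc(λ) = 2 / (2 + e^{−z·λ}·(cosh^l(z) + cosh^{−l}(z))). -/

import Mathlib

open Finset Real

/-- Spin value of a boolean: `true ↦ +1`, `false ↦ -1`. -/
noncomputable def spin (b : Bool) : ℝ := if b then 1 else -1

/-- The embedded star Hamiltonian
`H_e^λ = -λ·s₁·s₂ + (s₁+1)·(x₁+⋯+x_l) + (s₂-1)·(y₁+⋯+y_l)` on configurations
`σ = (s₁, s₂, x, y)`. -/
noncomputable def He (l : ℕ) (lam : ℝ)
    (σ : Bool × Bool × (Fin l → Bool) × (Fin l → Bool)) : ℝ :=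
  -lam * spin σ.1 * spin σ.2.1 + (spin σ.1 + 1) * (∑ i, spin (σ.2.2.1 i)) +
    (spin σ.2.1 - 1) * (∑ i, spin (σ.2.2.2 i))

/-- The partition function of `l` free spins in a uniform field `a`. -/
theorem sum_exp_mul_sum_spin (l : ℕ) (a : ℝ) :
    ∑ x : Fin l → Bool, Real.exp (a * ∑ i, spin (x i)) = (2 * Real.cosh a) ^ l := by
  have h : 2 * Real.cosh a = ∑ b : Bool, Real.exp (a * spin b) := by
    rw [Fintype.sum_bool, Real.cosh_eq]
    simp [spin]
    ring
  rw [h, Fintype.sum_pow]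
  exact Finset.sum_congr rfl fun x _ => by rw [Finset.mul_sum, Real.exp_sum]

/-- The Gibbs weight of a pair of center spins, summed over all leaf spins. -/
theorem sum_exp_He (l : ℕ) (lam β : ℝ) (s t : Bool) :
    ∑ p : (Fin l → Bool) × (Fin l → Bool), Real.exp (-β * He l lam (s, t, p)) =
      Real.exp (β * lam * spin s * spin t) * (2 * Real.cosh (β * (spin s + 1))) ^ l *
        (2 * Real.cosh (β * (spin t - 1))) ^ l := by
  rw [← Real.cosh_neg (β * (spin s + 1)), ← Real.cosh_neg (β * (spin t - 1)),
    ← sum_exp_mul_sum_spin, ← sum_exp_mul_sum_spin, mul_assoc, Finset.sum_mul_sum,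
    Finset.mul_sum, Fintype.sum_prod_type]
  refine Finset.sum_congr rfl fun x _ => ?_
  rw [Finset.mul_sum]
  refine Finset.sum_congr rfl fun y _ => ?_
  rw [← Real.exp_add, ← Real.exp_add, He]
  congr 1
  ring

/-- **Chain consistency probability of the embedded star Hamiltonian.**
Under Gibbs sampling at inverse temperature `βeff` (with `z = 2·βeff`), the
probability of the event `s₁ = s₂` equals
`2 / (2 + e^{-z·λ}·(cosh^l z + cosh^{-l} z))`. -/
theorem star_chain_consistency_probability (l : ℕ) (hl : 1 ≤ l) (lam βeff : ℝ)
    (hlam : 0 < lam) (hβ : 0 < βeff) (z : ℝ) (hz : z = 2 * βeff) :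
    (∑ σ ∈ Finset.univ.filter
          (fun σ : Bool × Bool × (Fin l → Bool) × (Fin l → Bool) => σ.1 = σ.2.1),
        Real.exp (-βeff * He l lam σ)) /
      (∑ σ : Bool × Bool × (Fin l → Bool) × (Fin l → Bool),
        Real.exp (-βeff * He l lam σ)) =
    2 / (2 + Real.exp (-(z * lam)) * (Real.cosh z ^ l + (Real.cosh z ^ l)⁻¹)) := by
  subst hz
  have hexp : Real.exp (-(2 * βeff * lam)) = Real.exp (-(βeff * lam)) / Real.exp (βeff * lam) := by
    rw [← Real.exp_sub]
    congr 1
    ring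
  have htwo : βeff * (1 + 1) = 2 * βeff := by ring
  have hneg : βeff * (-1 - 1) = -(2 * βeff) := by ring
  rw [Finset.sum_filter]
  simp only [Fintype.sum_prod_type (α₁ := Bool), Fintype.sum_bool, if_true, reduceCtorEq, if_false,
    Finset.sum_const_zero, sum_exp_He]
  simp only [spin, if_true, Bool.false_eq_true, if_false, htwo, hneg, Real.cosh_neg, sub_self,
    neg_add_cancel, mul_zero, Real.cosh_zero, mul_one, mul_neg, neg_neg, add_zero, zero_add,
    mul_pow, hexp]
  have hpos := pow_pos (Real.cosh_pos (2 * βeff)) l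
  rw [div_eq_div_iff (by positivity) (by positivity)]
  field_simp
  ring
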